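/- Let k ≥ 2 be an integer and let x ∈ A_k^ℕ satisfy δ_{s_k}(x) = p for some finite p ∈ ℕ. Then for every integer n ≥ 1, δ_{s_k}(s_k^n(x)) = Σ_{j∈A_k} |s_k^n(j)| · |x_{[0…p−1]}|_j + Σ_{l=0}^{n−1} |s_k^l(0)|. -/

import Mathlib

/-- The `k`-bonacci substitution on letters: `a ↦ 0(a+1)` if `a ≠ k-1`, and `k-1 ↦ 0`. -/
def sLetter {k : ℕ} (a : Fin k) : List (Fin k) :=
  if h : (a : ℕ) + 1 < k then
    [⟨0, Nat.lt_of_le_of_lt (Nat.zero_le _) a.isLt⟩, ⟨(a : ℕ) + 1, h⟩]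
  else
    [⟨0, Nat.lt_of_le_of_lt (Nat.zero_le _) a.isLt⟩]

/-- Extension of the substitution to finite words by concatenation. -/
def sWord {k : ℕ} (w : List (Fin k)) : List (Fin k) := w.flatMap sLetter

/-- The prefix of length `n` of a right-infinite sequence. -/
def pref {k : ℕ} (x : ℕ → Fin k) (n : ℕ) : List (Fin k) :=
  (List.range n).map x

/-- Extension of the substitution to right-infinite sequences, by concatenating the
images of the letters: since each letter has a nonempty image, the `m`-th letter of the
image is the `m`-th letter of the image of the prefix of length `m+1`. -/
def sSeq {k : ℕ} (x : ℕ → Fin k) : ℕ → Fin k :=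
  fun m => (sWord (pref x (m + 1))).getD m (x 0)

/-- The left shift on sequences. -/
def shift {k : ℕ} (x : ℕ → Fin k) : ℕ → Fin k := fun n => x (n + 1)

/-- The language of the substitution: finite words occurring as a subword of some `s^m(a)`. -/
def Lang {k : ℕ} (w : List (Fin k)) : Prop :=
  ∃ (a : Fin k) (m : ℕ), w <:+: sWord^[m] [a]

/-- `delta x = sup {n : prefix of x of length n is in the language}`, valued in `ℕ∞`. -/
noncomputable def delta {k : ℕ} (x : ℕ → Fin k) : ℕ∞ :=
  sSup {N : ℕ∞ | ∃ n : ℕ, N = (n : ℕ∞) ∧ Lang (pref x n)}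

/-- The subshift associated to the substitution: sequences all of whose subwords
lie in the language. -/
def Attr (k : ℕ) : Set (ℕ → Fin k) :=
  {x | ∀ i n, Lang ((List.range n).map (fun j => x (i + j)))}

/-- The renormalization operator. -/
noncomputable def Renorm {k : ℕ} (V : (ℕ → Fin k) → ℝ) : (ℕ → Fin k) → ℝ :=
  fun x => ∑ j ∈ Finset.range (sLetter (x 0)).length, V (shift^[j] (sSeq x))

/-- `vcoef k lam l = lam^{-(k-1-l)} * ∑_{j=0}^{k-1-l} lam^j`. -/
noncomputable def vcoef (k : ℕ) (lam : ℝ) (l : ℕ) : ℝ :=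
  (∑ j ∈ Finset.range (k - l), lam ^ j) / lam ^ (k - 1 - l)

/-- The fixed point of the renormalization operator. -/
noncomputable def Ufix (k : ℕ) (lam : ℝ) (x : ℕ → Fin k) : ℝ :=
  if delta x = ⊤ then 0
  else Real.log (1 + vcoef k lam (x 0) /
    (lam / (lam - 1)
      + (∑ l : Fin k, vcoef k lam (l : ℕ) * ((pref x (delta x).toNat).count l : ℝ))
      - vcoef k lam (x 0)))

/-- The word `s^n(0) · s^{n-1}(0) ⋯ s(0) · 0`. -/
def bword {k : ℕ} (z : Fin k) (n : ℕ) : List (Fin k) :=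
  ((List.range (n + 1)).map (fun i => sWord^[n - i] [z])).flatten

/-- The word `s^{n-1}(0) · s^{n-2}(0) ⋯ s(0) · 0`. -/
def bsuffix {k : ℕ} (z : Fin k) (n : ℕ) : List (Fin k) :=
  ((List.range n).map (fun i => sWord^[n - 1 - i] [z])).flatten

theorem sLetter_of_lt {k : ℕ} {z a : Fin k} (hz : (z : ℕ) = 0) (h : (a : ℕ) + 1 < k) :
    sLetter a = [z, ⟨a + 1, h⟩] := by
  have : (⟨0, Nat.lt_of_le_of_lt (Nat.zero_le _) a.isLt⟩ : Fin k) = z := Fin.ext hz.symm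
  simp [sLetter, h, this]

theorem sLetter_of_not_lt {k : ℕ} {z a : Fin k} (hz : (z : ℕ) = 0) (h : ¬ (a : ℕ) + 1 < k) :
    sLetter a = [z] := by
  have : (⟨0, Nat.lt_of_le_of_lt (Nat.zero_le _) a.isLt⟩ : Fin k) = z := Fin.ext hz.symm
  simp [sLetter, h, this]

theorem exists_sLetter_eq_cons {k : ℕ} {z : Fin k} (hz : (z : ℕ) = 0) (a : Fin k) :
    ∃ t, sLetter a = z :: t := by
  by_cases h : (a : ℕ) + 1 < k
  · exact ⟨_, sLetter_of_lt hz h⟩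
  · exact ⟨_, sLetter_of_not_lt hz h⟩

@[simp] theorem sWord_nil {k : ℕ} : sWord ([] : List (Fin k)) = [] := rfl

theorem sWord_cons {k : ℕ} (a : Fin k) (w : List (Fin k)) :
    sWord (a :: w) = sLetter a ++ sWord w := by
  simp [sWord]

theorem sWord_append {k : ℕ} (v w : List (Fin k)) : sWord (v ++ w) = sWord v ++ sWord w := by
  simp [sWord]

theorem sWord_isInfix {k : ℕ} {v w : List (Fin k)} (h : v <:+: w) : sWord v <:+: sWord w := by
  obtain ⟨l, r, rfl⟩ := h
  exact ⟨sWord l, sWord r, by simp [sWord_append]⟩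

theorem sWord_isPrefix {k : ℕ} {v w : List (Fin k)} (h : v <+: w) : sWord v <+: sWord w := by
  obtain ⟨r, rfl⟩ := h
  exact ⟨sWord r, by simp [sWord_append]⟩

theorem length_le_length_sWord {k : ℕ} (w : List (Fin k)) : w.length ≤ (sWord w).length := by
  induction w with
  | nil => simp
  | cons a w ih =>
    obtain ⟨t, ht⟩ := exists_sLetter_eq_cons (z := ⟨0, a.pos⟩) rfl a
    simp only [sWord_cons, ht, List.length_append, List.length_cons]
    omega

theorem iterate_sWord_append {k : ℕ} (n : ℕ) (v w : List (Fin k)) :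
    sWord^[n] (v ++ w) = sWord^[n] v ++ sWord^[n] w := by
  induction n generalizing v w with
  | zero => rfl
  | succ n ih => simp only [Function.iterate_succ_apply, sWord_append, ih]

theorem length_le_length_iterate_sWord {k : ℕ} (n : ℕ) (w : List (Fin k)) :
    w.length ≤ (sWord^[n] w).length := by
  induction n generalizing w with
  | zero => rfl
  | succ n ih => exact (length_le_length_sWord w).trans (ih _)

theorem length_iterate_sWord {k : ℕ} (n : ℕ) (w : List (Fin k)) :
    (sWord^[n] w).length = ∑ j : Fin k, (sWord^[n] [j]).length * w.count j := by
  induction w with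
  | nil =>
    have : sWord^[n] ([] : List (Fin k)) = [] := Function.iterate_fixed rfl n
    simp [this]
  | cons a w ih =>
    rw [← List.singleton_append, iterate_sWord_append, List.length_append, ih]
    simp [List.count_cons, mul_add, Finset.sum_add_distrib, add_comm]

theorem Lang.of_isInfix {k : ℕ} {v w : List (Fin k)} (hw : Lang w) (h : v <:+: w) : Lang v := by
  obtain ⟨a, m, hm⟩ := hw
  exact ⟨a, m, h.trans hm⟩

theorem Lang.map_sWord {k : ℕ} {w : List (Fin k)} (hw : Lang w) : Lang (sWord w) := by
  obtain ⟨a, m, hm⟩ := hw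
  exact ⟨a, m + 1, by rw [Function.iterate_succ_apply']; exact sWord_isInfix hm⟩

theorem Lang.iterate_map_sWord {k : ℕ} {w : List (Fin k)} (hw : Lang w) (n : ℕ) :
    Lang (sWord^[n] w) := by
  induction n with
  | zero => exact hw
  | succ n ih => rw [Function.iterate_succ_apply']; exact ih.map_sWord

theorem exists_lang_pair {k : ℕ} (hk : 2 ≤ k) (a : Fin k) : ∃ b, Lang [a, b] := by
  obtain ⟨i, hi⟩ := a
  induction i with
  | zero =>
    refine ⟨⟨1, hk⟩, ⟨0, hi⟩, 1, ?_⟩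
    have h : ((⟨0, hi⟩ : Fin k) : ℕ) + 1 < k := hk
    simp [sWord, sLetter_of_lt (z := ⟨0, hi⟩) rfl h]
  | succ i ih =>
    obtain ⟨b, hb⟩ := ih (by omega)
    refine ⟨⟨0, by omega⟩, hb.map_sWord.of_isInfix ?_⟩
    obtain ⟨t, ht⟩ := exists_sLetter_eq_cons (z := ⟨0, by omega⟩) rfl b
    refine ⟨[⟨0, by omega⟩], t, ?_⟩
    simp [sWord_cons, sLetter_of_lt (z := ⟨0, by omega⟩) (a := ⟨i, by omega⟩) rfl hi, ht]

/-- Every word of the language can be extended to the right. -/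
theorem Lang.exists_append {k : ℕ} (hk : 2 ≤ k) {w : List (Fin k)} (hw : Lang w) :
    ∃ b, Lang (w ++ [b]) := by
  obtain ⟨a, m, l, r, hm⟩ := hw
  obtain ⟨b, hb⟩ := exists_lang_pair hk a
  have h := hb.iterate_map_sWord m
  rw [← List.singleton_append, iterate_sWord_append, ← hm] at h
  have hlen := length_le_length_iterate_sWord m [b]
  obtain ⟨c, t, ht⟩ : ∃ c t, r ++ sWord^[m] [b] = c :: t := by
    refine List.exists_cons_of_ne_nil fun h0 => ?_
    simp_all
  refine ⟨c, h.of_isInfix ⟨l, t, ?_⟩⟩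
  simp [ht]

theorem Lang.sWord_append_zero {k : ℕ} (hk : 2 ≤ k) {z : Fin k} (hz : (z : ℕ) = 0)
    {w : List (Fin k)} (hw : Lang w) : Lang (sWord w ++ [z]) := by
  obtain ⟨b, hb⟩ := hw.exists_append hk
  obtain ⟨t, ht⟩ := exists_sLetter_eq_cons hz b
  exact hb.map_sWord.of_isInfix ⟨[], t, by simp [sWord_append, sWord_cons, ht]⟩

/-- The image of a letter together with the first letter of the next image, truncated to
length two. It determines the letter. -/
def marker {k : ℕ} (z a : Fin k) : List (Fin k) :=
  if h : (a : ℕ) + 1 < k then [z, ⟨a + 1, h⟩] else [z, z]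

theorem exists_eq_of_suffix_sWord {k : ℕ} {z : Fin k} (hz : (z : ℕ) = 0) {t u : List (Fin k)}
    (h : z :: t <:+ sWord u) : ∃ u', u' <:+ u ∧ z :: t = sWord u' := by
  induction u with
  | nil => simp at h
  | cons b u ih =>
    by_cases hu : z :: t <:+ sWord u
    · obtain ⟨u', h1, h2⟩ := ih hu
      exact ⟨u', h1.trans (List.suffix_cons b u), h2⟩
    refine ⟨b :: u, List.suffix_rfl, ?_⟩
    by_cases hb : (b : ℕ) + 1 < k
    · rw [sWord_cons, sLetter_of_lt hz hb] at h ⊢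
      simp only [List.cons_append, List.nil_append] at h ⊢
      rcases List.suffix_cons_iff.1 h with h | h
      · exact h
      rcases List.suffix_cons_iff.1 h with h | h
      · have := congrArg Fin.val (List.cons.inj h).1
        simp [hz] at this
      · exact absurd h hu
    · rw [sWord_cons, sLetter_of_not_lt hz hb] at h ⊢
      simp only [List.cons_append, List.nil_append] at h ⊢
      rcases List.suffix_cons_iff.1 h with h | h
      · exact h
      · exact absurd h hu

theorem eq_cons_of_marker_isPrefix {k : ℕ} {z : Fin k} (hz : (z : ℕ) = 0) {a : Fin k}
    {u : List (Fin k)} (h : marker z a <+: sWord u) : ∃ u', u = a :: u' := by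
  rcases u with _ | ⟨b, u⟩
  · unfold marker at h
    split at h <;> simp at h
  refine ⟨u, ?_⟩
  congr 1
  have hlt := a.isLt
  have hlt' := b.isLt
  unfold marker at h
  by_cases hb : (b : ℕ) + 1 < k
  · rw [sWord_cons, sLetter_of_lt hz hb] at h
    split at h
    · simp only [List.cons_append, List.cons_prefix_cons, Fin.ext_iff] at h
      exact Fin.ext (by omega)
    · simp only [List.cons_append, List.cons_prefix_cons, Fin.ext_iff] at h
      omega
  · rw [sWord_cons, sLetter_of_not_lt hz hb] at h
    split at h
    · rcases u with _ | ⟨c, u⟩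
      · simp at h
      · obtain ⟨t, ht⟩ := exists_sLetter_eq_cons hz c
        simp only [sWord_cons, ht, List.cons_append, List.nil_append, List.cons_prefix_cons,
          Fin.ext_iff] at h
        omega
    · exact Fin.ext (by omega)

theorem marker_prefix_append {k : ℕ} {z : Fin k} (hz : (z : ℕ) = 0) (a : Fin k)
    {v : List (Fin k)} (hv : [z] <+: v) : marker z a <+: sLetter a ++ v := by
  unfold marker
  split
  next h => simp [sLetter_of_lt hz h]
  next h => simpa [sLetter_of_not_lt hz h] using hv

theorem zero_prefix_sWord_append_marker {k : ℕ} {z : Fin k} (hz : (z : ℕ) = 0)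
    (w : List (Fin k)) (a : Fin k) : [z] <+: sWord w ++ marker z a := by
  rcases w with _ | ⟨b, w⟩
  · unfold marker
    split <;> simp
  · obtain ⟨t, ht⟩ := exists_sLetter_eq_cons hz b
    simp [sWord_cons, ht]

theorem append_prefix_of_sWord_append_marker_isPrefix {k : ℕ} {z : Fin k} (hz : (z : ℕ) = 0)
    {w u : List (Fin k)} {a : Fin k} (h : sWord w ++ marker z a <+: sWord u) :
    w ++ [a] <+: u := by
  induction w generalizing u with
  | nil =>
    obtain ⟨u', rfl⟩ := eq_cons_of_marker_isPrefix hz h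
    simp
  | cons b w ih =>
    rw [sWord_cons, List.append_assoc] at h
    obtain ⟨u', rfl⟩ := eq_cons_of_marker_isPrefix hz
      ((marker_prefix_append hz b (zero_prefix_sWord_append_marker hz w a)).trans h)
    rw [sWord_cons, List.prefix_append_right_inj] at h
    simpa using ih h

theorem length_marker {k : ℕ} (z a : Fin k) : (marker z a).length = 2 := by
  unfold marker
  split <;> rfl

/-- Desubstitution inside the language. -/
theorem Lang.of_sWord_append_marker {k : ℕ} {z : Fin k} (hz : (z : ℕ) = 0)
    {w : List (Fin k)} {a : Fin k} (h : Lang (sWord w ++ marker z a)) :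
    Lang (w ++ [a]) := by
  obtain ⟨b, m, l, r, h⟩ := h
  rcases m with _ | m
  · have := congrArg List.length h
    simp [length_marker] at this
    omega
  rw [Function.iterate_succ_apply'] at h
  obtain ⟨t, ht⟩ := zero_prefix_sWord_append_marker hz w a
  rw [← ht] at h
  obtain ⟨u', h1, h2⟩ := exists_eq_of_suffix_sWord hz (z := z) (t := t ++ r)
    (u := sWord^[m] [b]) ⟨l, by simpa using h⟩
  refine ⟨b, m, List.IsInfix.trans (List.IsPrefix.isInfix ?_) h1.isInfix⟩
  refine append_prefix_of_sWord_append_marker_isPrefix hz (z := z) ⟨r, ?_⟩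
  rw [← h2, ← ht]
  simp

theorem pref_succ {k : ℕ} (x : ℕ → Fin k) (n : ℕ) : pref x (n + 1) = pref x n ++ [x n] := by
  simp [pref, List.range_succ]

theorem length_pref {k : ℕ} (x : ℕ → Fin k) (n : ℕ) : (pref x n).length = n := by
  simp [pref]

theorem pref_prefix_pref {k : ℕ} (x : ℕ → Fin k) {m n : ℕ} (h : m ≤ n) :
    pref x m <+: pref x n := by
  induction n, h using Nat.le_induction with
  | base => exact List.prefix_rfl
  | succ n _ ih => exact ih.trans (by simp [pref_succ])

theorem sSeq_eq_of_lt {k : ℕ} (x : ℕ → Fin k) {i n : ℕ} (h : i < (sWord (pref x n)).length) :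
    (sWord (pref x n))[i] = sSeq x i := by
  have hi : i < (sWord (pref x (i + 1))).length := by
    have := length_le_length_sWord (pref x (i + 1))
    rw [length_pref] at this
    omega
  have h1 := (sWord_isPrefix (pref_prefix_pref x (le_max_left n (i + 1)))).getElem h
  have h2 := (sWord_isPrefix (pref_prefix_pref x (le_max_right n (i + 1)))).getElem hi
  rw [h1, sSeq, List.getD_eq_getElem _ _ hi, h2]

theorem pref_sSeq_of_isPrefix {k : ℕ} (x : ℕ → Fin k) {n : ℕ} {v : List (Fin k)}
    (h : v <+: sWord (pref x n)) : pref (sSeq x) v.length = v := by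
  refine List.ext_getElem (length_pref _ _) fun i h1 h2 => ?_
  rw [h.getElem h2, sSeq_eq_of_lt]
  simp [pref]

theorem pref_sSeq_length_add_one {k : ℕ} {z : Fin k} (hz : (z : ℕ) = 0) (x : ℕ → Fin k) (p : ℕ) :
    pref (sSeq x) ((sWord (pref x p)).length + 1) = sWord (pref x p) ++ [z] := by
  obtain ⟨t, ht⟩ := exists_sLetter_eq_cons hz (x p)
  simpa using pref_sSeq_of_isPrefix x (n := p + 1) (v := sWord (pref x p) ++ [z])
    (by simp [pref_succ, sWord_append, sWord_cons, ht])

theorem pref_sSeq_length_add_two {k : ℕ} {z : Fin k} (hz : (z : ℕ) = 0) (x : ℕ → Fin k) (p : ℕ) :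
    pref (sSeq x) ((sWord (pref x p)).length + 2) = sWord (pref x p) ++ marker z (x p) := by
  obtain ⟨t, ht⟩ := exists_sLetter_eq_cons hz (x (p + 1))
  have h := pref_sSeq_of_isPrefix x (n := p + 2) (v := sWord (pref x p) ++ marker z (x p)) (by
    rw [pref_succ, pref_succ, sWord_append, sWord_append, List.append_assoc,
      List.prefix_append_right_inj]
    simpa [sWord_cons] using marker_prefix_append hz (x p) (v := sLetter (x (p + 1))) (by simp [ht]))
  simpa [length_marker] using h

theorem lang_nil {k : ℕ} (a : Fin k) : Lang ([] : List (Fin k)) :=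
  ⟨a, 0, by simp⟩

theorem delta_eq_coe_iff {k : ℕ} (x : ℕ → Fin k) (p : ℕ) :
    delta x = p ↔ Lang (pref x p) ∧ ¬ Lang (pref x (p + 1)) := by
  constructor
  · intro h
    have hle : ∀ n, Lang (pref x n) → n ≤ p := fun n hn => by
      have : (n : ℕ∞) ≤ delta x := le_sSup ⟨n, rfl, hn⟩
      rw [h] at this
      exact_mod_cast this
    refine ⟨?_, fun h' => by have := hle _ h'; omega⟩
    rcases p with _ | p
    · exact lang_nil (x 0)
    · have hlt : (p : ℕ∞) < delta x := by
        rw [h]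
        exact_mod_cast p.lt_succ_self
      obtain ⟨_, ⟨n, rfl, hn⟩, hpn⟩ := lt_sSup_iff.1 hlt
      have hpn : p < n := by exact_mod_cast hpn
      exact hn.of_isInfix (pref_prefix_pref x hpn).isInfix
  · rintro ⟨h1, h2⟩
    refine le_antisymm (sSup_le ?_) (le_sSup ⟨p, rfl, h1⟩)
    rintro _ ⟨n, rfl, hn⟩
    by_contra! hlt
    have hlt : p < n := by exact_mod_cast hlt
    exact h2 (hn.of_isInfix (pref_prefix_pref x hlt).isInfix)

theorem delta_sSeq {k : ℕ} (hk : 2 ≤ k) {x : ℕ → Fin k} {p : ℕ} (hp : delta x = p) :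
    delta (sSeq x) = ((sWord (pref x p)).length + 1 : ℕ) := by
  have hz : ((⟨0, by omega⟩ : Fin k) : ℕ) = 0 := rfl
  rw [delta_eq_coe_iff] at hp ⊢
  rw [pref_sSeq_length_add_one hz, pref_sSeq_length_add_two hz]
  refine ⟨hp.1.sWord_append_zero hk hz, fun h => hp.2 ?_⟩
  rw [pref_succ]
  exact h.of_sWord_append_marker hz

theorem delta_iterate_sSeq {k : ℕ} (hk : 2 ≤ k) {z : Fin k} (hz : (z : ℕ) = 0) (n : ℕ)
    {x : ℕ → Fin k} {p : ℕ} (hp : delta x = p) :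
    delta (sSeq^[n] x) =
      ((sWord^[n] (pref x p)).length + ∑ l ∈ Finset.range n, (sWord^[l] [z]).length : ℕ) := by
  induction n generalizing x p with
  | zero => simp [hp, length_pref]
  | succ n ih =>
    rw [Function.iterate_succ_apply, ih (delta_sSeq hk hp), pref_sSeq_length_add_one hz,
      iterate_sWord_append, List.length_append, Finset.sum_range_succ,
      Function.iterate_succ_apply, add_assoc,
      add_comm (∑ l ∈ Finset.range n, (sWord^[l] [z]).length)]

theorem stmt3 (k : ℕ) (hk : 2 ≤ k) (z0 : Fin k) (hz : (z0 : ℕ) = 0)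
    (x : ℕ → Fin k) (p : ℕ) (hp : delta x = (p : ℕ∞)) (n : ℕ) (hn : 1 ≤ n) :
    delta (sSeq^[n] x) =
      ((∑ j : Fin k, (sWord^[n] [j]).length * (pref x p).count j
          + ∑ l ∈ Finset.range n, (sWord^[l] [z0]).length : ℕ) : ℕ∞) := by
  rw [delta_iterate_sSeq hk hz n hp, length_iterate_sWord]
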